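/- Let β > 0, let β̃ := −(1/2)·ln(tanh β) and Γ := √(sinh β · cosh β). Then for all s, σ₁, σ₂ ∈ {−1, 1} (as real numbers), with τ₁ := (1−σ₁)/2 and τ₂ := (1−σ₂)/2 ∈ {0,1}, one has ∑_{t ∈ {−1,1}} ∑_{γ ∈ {−1,1}} e^{β γ s t} · (tγ)^{τ₁+τ₂} = 4 · Γ · s^{τ₁+τ₂} · e^{β̃ σ₁ σ₂}. (This is the local identity establishing that the Kramers–Wannier duality interface D between the gauged Ising model at inverse temperature β and the Ising model at the dual inverse temperature β̃ is topological.) -/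

import Mathlib

/-- The local identity establishing that the Kramers–Wannier duality interface
`D` between the gauged Ising model at inverse temperature `β` and the Ising
model at the dual inverse temperature `β̃` is topological. -/
theorem ising_duality_interface_topological (β βd Γ : ℝ) (hβ : 0 < β)
    (hβd : βd = -(1 / 2) * Real.log (Real.tanh β))
    (hΓ : Γ = Real.sqrt (Real.sinh β * Real.cosh β))
    (s σ₁ σ₂ : ℝ) (hs : s ∈ ({-1, 1} : Set ℝ))
    (h₁ : σ₁ ∈ ({-1, 1} : Set ℝ)) (h₂ : σ₂ ∈ ({-1, 1} : Set ℝ))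
    (τ₁ τ₂ : ℕ)
    (hτ₁ : (τ₁ : ℝ) = (1 - σ₁) / 2) (hτ₂ : (τ₂ : ℝ) = (1 - σ₂) / 2) :
    ∑ t ∈ ({-1, 1} : Finset ℝ), ∑ γ ∈ ({-1, 1} : Finset ℝ),
        Real.exp (β * γ * s * t) * (t * γ) ^ (τ₁ + τ₂)
      = 4 * Γ * s ^ (τ₁ + τ₂) * Real.exp (βd * (σ₁ * σ₂)) := by
  have hS : 0 < Real.sinh β := Real.sinh_pos_iff.mpr hβ
  have hC : 0 < Real.cosh β := Real.cosh_pos β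
  have hG : Γ = Real.exp ((Real.log (Real.sinh β) + Real.log (Real.cosh β)) / 2) := by
    rw [hΓ, ← Real.log_mul hS.ne' hC.ne', Real.exp_half, Real.exp_log (mul_pos hS hC)]
  have hb : βd = (Real.log (Real.cosh β) - Real.log (Real.sinh β)) / 2 := by
    rw [hβd, Real.tanh_eq_sinh_div_cosh, Real.log_div hS.ne' hC.ne']
    ring
  have e1 : Γ * Real.exp βd = (Real.exp β + Real.exp (-β)) / 2 := by
    rw [← Real.cosh_eq, hG, hb, ← Real.exp_add]
    ring_nf
    exact Real.exp_log hC
  have e2 : Γ * Real.exp (-βd) = (Real.exp β - Real.exp (-β)) / 2 := by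
    rw [← Real.sinh_eq, hG, hb, ← Real.exp_add]
    ring_nf
    exact Real.exp_log hS
  clear hβd hΓ hG hb
  have hne : (-1 : ℝ) ≠ 1 := by norm_num
  simp only [Finset.sum_pair hne]
  rcases h₁ with rfl | rfl <;> rcases h₂ with rfl | rfl <;> norm_num at hτ₁ hτ₂ <;>
    subst hτ₁ <;> subst hτ₂ <;> rcases hs with rfl | rfl <;> norm_num <;> linarith
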